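/- Let r ≥ 1 and let n_1,…,n_r, m_1,…,m_r be positive integers with n_1+⋯+n_r = m_1+⋯+m_r and n_1 = min{n_1, m_1, …, n_r, m_r}. Then φ(1^{n_1}0^{m_1}⋯1^{n_r}0^{m_r}) ≤ φ*(n_1, n_2, …, n_r). -/

import Mathlib

/-- A pairing of the positions `Fin N`: a collection of blocks, each of size 2,
with every position in exactly one block. -/
def IsPairing {N : ℕ} (π : Finset (Finset (Fin N))) : Prop :=
  (∀ B ∈ π, B.card = 2) ∧ ∀ i : Fin N, ∃! B, B ∈ π ∧ i ∈ B

/-- A crossing: blocks `{i₁,i₂}` and `{j₁,j₂}` with `i₁ < j₁ < i₂ < j₂`. -/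
def HasCrossing {N : ℕ} (π : Finset (Finset (Fin N))) : Prop :=
  ∃ B ∈ π, ∃ C ∈ π, ∃ i₁ i₂ j₁ j₂ : Fin N,
    i₁ ∈ B ∧ i₂ ∈ B ∧ j₁ ∈ C ∧ j₂ ∈ C ∧ i₁ < j₁ ∧ j₁ < i₂ ∧ i₂ < j₂

/-- A non-crossing `w`-pairing: a non-crossing pairing of the positions of the
bitstring `w` (ones are `true`, zeros are `false`) pairing unequal letters. -/
def IsNCPairingOn (w : List Bool) (π : Finset (Finset (Fin w.length))) : Prop :=
  IsPairing π ∧ ¬ HasCrossing π ∧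
    ∀ B ∈ π, ∀ i ∈ B, ∀ j ∈ B, i ≠ j → w.get i ≠ w.get j

/-- `phi w` is the number of non-crossing `w`-pairings. -/
noncomputable def phi (w : List Bool) : ℕ :=
  Set.ncard {π : Finset (Finset (Fin w.length)) | IsNCPairingOn w π}

/-- The word `1^{n 0} 0^{m 0} 1^{n 1} 0^{m 1} ⋯ 1^{n (r-1)} 0^{m (r-1)}`. -/
def runsF {r : ℕ} (n m : Fin r → ℕ) : List Bool :=
  (List.finRange r).flatMap fun i => List.replicate (n i) true ++ List.replicate (m i) false

/-- The word `1^{k₁} 0^{k₁} ⋯ 1^{k_r} 0^{k_r}` for `l = [k₁, …, k_r]`. -/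
def symWord (l : List ℕ) : List Bool :=
  l.flatMap fun k => List.replicate k true ++ List.replicate k false

/-- The symmetrized pairing function `φ*(n₁,…,n_r) = φ(1^{n₁}0^{n₁}⋯1^{n_r}0^{n_r})`. -/
noncomputable def phiStar (l : List ℕ) : ℕ := phi (symWord l)

/-- `Yval w i` is the lattice-path value `Y_i`. -/
def Yval (w : List Bool) (i : ℕ) : ℤ :=
  ((w.take i).count true : ℤ) - ((w.take i).count false : ℤ)

/-- The height of position `i` of `w`, relative to the minimum `mY` of the `Y_i`. -/
def heightAt (w : List Bool) (mY : ℤ) (i : Fin w.length) : ℤ :=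
  if w.get i then Yval w (i.val + 1) - mY else Yval w (i.val + 1) - mY + 1

/-- `d : Fin r → ℕ` is a Catalan degree sequence of order `r`. -/
def IsCatalanSeq (r : ℕ) (d : Fin r → ℕ) : Prop :=
  (∀ i : ℕ, 1 ≤ i → i ≤ r - 1 →
      (i : ℕ) ≤ ∑ j ∈ Finset.univ.filter (fun j : Fin r => (j : ℕ) < i), d j) ∧
  ∑ j, d j = r - 1

/-- Sum of the first `j` values of `f`. -/
def prefSum {r : ℕ} (f : Fin r → ℕ) (j : ℕ) : ℕ :=
  ∑ i ∈ Finset.univ.filter (fun i : Fin r => (i : ℕ) < j), f i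

/-- `m` is a member of `CF(n)`. -/
def InCF {r : ℕ} (n m : Fin r → ℕ) : Prop :=
  (∀ j : ℕ, 1 ≤ j → j ≤ r - 1 → prefSum m j ≤ prefSum n j) ∧
  (∑ i, m i = ∑ i, n i)

/-- The sum of `F u v` over all factorizations `w = u ++ b :: v`. -/
def splitSum (b : Bool) (F : List Bool → List Bool → ℕ) (w : List Bool) : ℕ :=
  ∑ i ∈ Finset.range w.length, if w[i]? = some b then F (w.take i) (w.drop (i + 1)) else 0

theorem splitSum_nil (b : Bool) (F : List Bool → List Bool → ℕ) : splitSum b F [] = 0 := by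
  simp [splitSum]

theorem splitSum_cons (b c : Bool) (F : List Bool → List Bool → ℕ) (w : List Bool) :
    splitSum b F (c :: w) =
      (if c = b then F [] w else 0) + splitSum b (fun u v => F (c :: u) v) w := by
  simp [splitSum, Finset.sum_range_succ', add_comm]

theorem splitSum_append (b : Bool) (F : List Bool → List Bool → ℕ) (w₁ w₂ : List Bool) :
    splitSum b F (w₁ ++ w₂) =
      splitSum b (fun u v => F u (v ++ w₂)) w₁ + splitSum b (fun u v => F (w₁ ++ u) v) w₂ := by
  induction w₁ generalizing F with
  | nil => simp [splitSum_nil]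
  | cons c w ih => simp [splitSum_cons, ih, add_assoc]

theorem splitSum_replicate_ne {b c : Bool} (h : c ≠ b) (F : List Bool → List Bool → ℕ) (k : ℕ) :
    splitSum b F (List.replicate k c) = 0 := by
  induction k generalizing F with
  | zero => simp [splitSum_nil]
  | succ k ih => simp [List.replicate_succ, splitSum_cons, ih, h]

theorem splitSum_replicate_self (b : Bool) (F : List Bool → List Bool → ℕ) (k : ℕ) :
    splitSum b F (List.replicate k b) =
      ∑ i ∈ Finset.range k, F (List.replicate i b) (List.replicate (k - 1 - i) b) := by
  rw [splitSum, List.length_replicate]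
  refine Finset.sum_congr rfl fun i hi => ?_
  have hi := Finset.mem_range.1 hi
  rw [if_pos (by simp [hi])]
  congr 1
  · simp [hi.le]
  · simp; omega

theorem splitSum_congr_of_length (b : Bool) {F G : List Bool → List Bool → ℕ} (w : List Bool)
    (h : ∀ u v, u.length < w.length → v.length < w.length → F u v = G u v) :
    splitSum b F w = splitSum b G w := by
  refine Finset.sum_congr rfl fun i hi => ?_
  have hi := Finset.mem_range.1 hi
  rw [h _ _ (by simp; omega) (by simp; omega)]

theorem splitSum_add (b : Bool) (F G : List Bool → List Bool → ℕ) (w : List Bool) :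
    splitSum b (fun u v => F u v + G u v) w = splitSum b F w + splitSum b G w := by
  rw [splitSum, splitSum, splitSum, ← Finset.sum_add_distrib]
  exact Finset.sum_congr rfl fun i _ => by split_ifs <;> rfl

theorem splitSum_const_mul (b : Bool) (c : ℕ) (F : List Bool → List Bool → ℕ) (w : List Bool) :
    splitSum b (fun u v => c * F u v) w = c * splitSum b F w := by
  rw [splitSum, splitSum, Finset.mul_sum]
  exact Finset.sum_congr rfl fun i _ => by split_ifs <;> simp

/-- Summing over factorizations `w = p ++ b :: q ++ c :: v` in either order. -/
theorem splitSum_splitSum (b c : Bool) (F : List Bool → List Bool → List Bool → ℕ)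
    (w : List Bool) :
    splitSum b (fun p x => splitSum c (fun q v => F p q v) x) w =
      splitSum c (fun y v => splitSum b (fun p q => F p q v) y) w := by
  induction w generalizing F with
  | nil => simp [splitSum_nil]
  | cons d w ih =>
    rw [splitSum_cons, splitSum_cons, ih]
    simp only [splitSum_cons, splitSum_nil, splitSum_add]
    by_cases h : d = b <;> simp [h, splitSum]

/-- The number of noncrossing pairings of a bitstring, by recursion on the partner of the
first letter. -/
def pairCount : List Bool → ℕ
  | [] => 1
  | a :: w => ∑ i ∈ Finset.range w.length,
      if w[i]? = some (!a) then pairCount (w.take i) * pairCount (w.drop (i + 1)) else 0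
termination_by w => w.length
decreasing_by all_goals simp

theorem pairCount_nil : pairCount [] = 1 := by simp [pairCount]

theorem pairCount_cons (a : Bool) (w : List Bool) :
    pairCount (a :: w) = splitSum (!a) (fun u v => pairCount u * pairCount v) w := by
  rw [pairCount, splitSum]

theorem pairCount_concat (w : List Bool) (a : Bool) :
    pairCount (w ++ [a]) = splitSum (!a) (fun u v => pairCount u * pairCount v) w := by
  induction hN : w.length using Nat.strong_induction_on generalizing w a with
  | _ N ih =>
    cases w with
    | nil => simp [pairCount_cons, splitSum_nil]
    | cons b x =>
      rw [List.cons_append, pairCount_cons, splitSum_append, splitSum_cons, splitSum_cons,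
        splitSum_nil]
      rw [splitSum_congr_of_length (!b) x (G := fun u v =>
        splitSum (!a) (fun q z => pairCount u * pairCount q * pairCount z) v)]
      · rw [splitSum_splitSum, add_comm]
        congr 1
        · cases a <;> cases b <;> simp [pairCount_nil]
        · congr 1
          funext u v
          rw [pairCount_cons, mul_comm (splitSum _ _ _), ← splitSum_const_mul]
          congr 1
          funext p q
          ring
      · intro u v _ hv
        rw [ih v.length (by simp at hN; omega) v a rfl, ← splitSum_const_mul]
        simp only [mul_assoc]

theorem pairCount_append_comm (u v : List Bool) : pairCount (u ++ v) = pairCount (v ++ u) := by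
  induction u generalizing v with
  | nil => simp
  | cons a u ih =>
    have : v ++ a :: u = (v ++ [a]) ++ u := by simp
    rw [this, ← ih, ← List.append_assoc, pairCount_concat, List.cons_append, pairCount_cons]

theorem count_eq_of_pairCount_ne_zero (w : List Bool) (h : pairCount w ≠ 0) :
    w.count true = w.count false := by
  induction hN : w.length using Nat.strong_induction_on generalizing w with
  | _ N ih =>
    cases w with
    | nil => simp
    | cons a w =>
      rw [pairCount] at h
      obtain ⟨i, hi, hne⟩ := Finset.exists_ne_zero_of_sum_ne_zero h
      have hi := Finset.mem_range.1 hi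
      split_ifs at hne with hw; swap
      · exact absurd rfl hne
      have h1 := ih _ (by simp at hN ⊢; omega) (w.take i) (left_ne_zero_of_mul hne) rfl
      have h2 := ih _ (by simp at hN ⊢; omega) (w.drop (i + 1)) (right_ne_zero_of_mul hne) rfl
      have hsplit : w = w.take i ++ (!a) :: w.drop (i + 1) := by
        rw [List.getElem?_eq_getElem hi, Option.some.injEq] at hw
        rw [← hw, List.getElem_cons_drop, List.take_append_drop]
      rw [hsplit]
      cases a <;> simp <;> omega

/-- The word `1^{n₁} 0^{m₁} 1^{n₂} 0^{m₂} ⋯` of a list of pairs `(nᵢ, mᵢ)`. -/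
def runWord (L : List (ℕ × ℕ)) : List Bool :=
  L.flatMap fun p => List.replicate p.1 true ++ List.replicate p.2 false

theorem runWord_nil : runWord [] = [] := rfl

theorem runWord_cons (n m : ℕ) (L : List (ℕ × ℕ)) :
    runWord ((n, m) :: L) =
      List.replicate n true ++ (List.replicate m false ++ runWord L) := by
  simp [runWord]

theorem runWord_append (L L' : List (ℕ × ℕ)) : runWord (L ++ L') = runWord L ++ runWord L' := by
  simp [runWord]

theorem symWord_cons (k : ℕ) (l : List ℕ) :
    symWord (k :: l) = List.replicate k true ++ (List.replicate k false ++ symWord l) := by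
  simp [symWord]

theorem symWord_append (l l' : List ℕ) : symWord (l ++ l') = symWord l ++ symWord l' := by
  simp [symWord]

/-- The sum of `A p * C q` over all factorizations `l = p ++ q`. -/
def splitConv (A C : List ℕ → ℕ) : List ℕ → ℕ
  | [] => A [] * C []
  | n :: l => A [] * C (n :: l) + splitConv (fun p => A (n :: p)) C l

/-- The sum of the products of the symmetrized pairing functions of the pieces, over all
factorizations of a list into `k + 1` consecutive, possibly empty, pieces. -/
def symConv : ℕ → List ℕ → ℕ
  | 0 => fun l => pairCount (symWord l)
  | k + 1 => splitConv (fun p => pairCount (symWord p)) (symConv k)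

theorem sum_replicate_mul_le (pre w : List Bool) (m A C : ℕ)
    (hA : ∀ i, pairCount (pre ++ List.replicate i false) ≤ A)
    (hC : ∀ j, pairCount (List.replicate j false ++ w) ≤ C) :
    ∑ i ∈ Finset.range m, pairCount (pre ++ List.replicate i false) *
      pairCount (List.replicate (m - 1 - i) false ++ w) ≤ A * C := by
  by_cases h : ∃ i ∈ Finset.range m, pairCount (pre ++ List.replicate i false) ≠ 0
  · obtain ⟨i, hi, hne⟩ := h
    rw [Finset.sum_eq_single_of_mem i hi]
    · exact Nat.mul_le_mul (hA i) (hC _)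
    · intro j _ hji
      by_contra hj
      have h1 := count_eq_of_pairCount_ne_zero _ hne
      have h2 := count_eq_of_pairCount_ne_zero _ (left_ne_zero_of_mul hj)
      simp [List.count_replicate] at h1 h2
      omega
  · push Not at h
    rw [Finset.sum_eq_zero fun i hi => by rw [h i hi, zero_mul]]
    exact Nat.zero_le _

theorem splitSum_runWord_le (k : ℕ) (C : List ℕ → ℕ) (B : List (ℕ × ℕ)) (m : ℕ)
    (pre : List Bool) (A : List ℕ → ℕ)
    (hA : ∀ (P : List (ℕ × ℕ)) (i : ℕ), P.length ≤ B.length →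
      pairCount (pre ++ (List.replicate i false ++ runWord P)) ≤ A (P.map Prod.fst))
    (hC : ∀ (Q : List (ℕ × ℕ)) (j : ℕ), Q.length ≤ B.length →
      pairCount (List.replicate j false ++ (runWord Q ++ List.replicate k true)) ≤
        C (Q.map Prod.fst)) :
    splitSum false (fun u v => pairCount (pre ++ u) * pairCount v)
      (List.replicate m false ++ (runWord B ++ List.replicate k true)) ≤
        splitConv A C (B.map Prod.fst) := by
  induction B generalizing m pre A with
  | nil =>
    rw [splitSum_append, splitSum_replicate_self, runWord_nil, List.nil_append,
      splitSum_replicate_ne (by simp), add_zero]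
    exact sum_replicate_mul_le _ _ _ _ _ (fun i => by simpa [runWord_nil] using hA [] i)
      (fun j => by simpa [runWord_nil] using hC [] j)
  | cons p B ih =>
    obtain ⟨n, m'⟩ := p
    rw [splitSum_append, splitSum_replicate_self, List.map_cons, splitConv]
    refine Nat.add_le_add ?_ ?_
    · exact sum_replicate_mul_le _ _ _ _ _
        (fun i => by simpa [runWord_nil] using hA [] i)
        (fun j => hC ((n, m') :: B) j le_rfl)
    · rw [runWord_cons, List.append_assoc, List.append_assoc, splitSum_append,
        splitSum_replicate_ne (by simp), zero_add]
      have := ih m' (pre ++ (List.replicate m false ++ List.replicate n true))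
        (fun q => A (n :: q))
        (fun P i hP => by
          have := hA ((n, i) :: P) m (by simpa using hP)
          simpa [runWord_cons] using this)
        (fun Q j hQ => hC Q j (by simp; omega))
      simpa using this

theorem pairCount_le_symConv (B : List (ℕ × ℕ))
    (hB : ∀ (P : List (ℕ × ℕ)) (i : ℕ), P.length ≤ B.length →
      pairCount (List.replicate i false ++ runWord P) ≤ pairCount (symWord (P.map Prod.fst)))
    (k : ℕ) (Q : List (ℕ × ℕ)) (m : ℕ) (hQ : Q.length ≤ B.length) :
    pairCount (List.replicate m false ++ (runWord Q ++ List.replicate k true)) ≤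
      symConv k (Q.map Prod.fst) := by
  induction k generalizing Q m with
  | zero => simpa [symConv] using hB Q m hQ
  | succ k ih =>
    rw [List.replicate_succ', ← List.append_assoc, ← List.append_assoc, pairCount_append_comm,
      List.singleton_append, pairCount_cons, List.append_assoc]
    exact splitSum_runWord_le k (symConv k) Q m [] _ (fun P i hP => hB P i (hP.trans hQ))
      (fun Q' j hQ' => ih Q' j (hQ'.trans hQ))

theorem mul_le_sum_replicate (k : ℕ) (C : List ℕ → ℕ) (n : ℕ) (l : List ℕ)
    (pre : List Bool) (A : List ℕ → ℕ) (hl : ∀ x ∈ n :: l, k + 1 ≤ x)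
    (hA : ∀ x : ℕ, k + 1 ≤ x → A [x] ≤ pairCount
      (pre ++ (List.replicate x true ++ List.replicate (x - (k + 1)) false)))
    (hC : ∀ q : List ℕ, (∀ x ∈ q, k + 1 ≤ x) →
      C q ≤ pairCount (List.replicate k false ++ (symWord q ++ List.replicate k true))) :
    A [n] * C l ≤ ∑ i ∈ Finset.range n,
      pairCount (pre ++ (List.replicate n true ++ List.replicate i false)) *
        pairCount (List.replicate (n - 1 - i) false ++
          (symWord l ++ List.replicate k true)) := by
  have hn : k + 1 ≤ n := hl n (by simp)
  refine le_trans ?_ (Finset.single_le_sum (fun _ _ => Nat.zero_le _)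
    (Finset.mem_range.2 (show n - (k + 1) < n by omega)))
  refine Nat.mul_le_mul (hA n hn) ?_
  have : n - 1 - (n - (k + 1)) = k := by omega
  rw [this]
  exact hC l fun x hx => hl x (by simp [hx])

theorem splitConv_le_splitSum (k : ℕ) (C : List ℕ → ℕ) (n : ℕ) (l : List ℕ)
    (pre : List Bool) (A : List ℕ → ℕ) (hl : ∀ x ∈ n :: l, k + 1 ≤ x)
    (hA : ∀ (p : List ℕ) (x : ℕ), k + 1 ≤ x → A (p ++ [x]) ≤ pairCount
      (pre ++ (symWord p ++ (List.replicate x true ++ List.replicate (x - (k + 1)) false))))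
    (hC : ∀ q : List ℕ, (∀ x ∈ q, k + 1 ≤ x) →
      C q ≤ pairCount (List.replicate k false ++ (symWord q ++ List.replicate k true))) :
    splitConv (fun p => A (n :: p)) C l ≤
      splitSum false (fun u v => pairCount (pre ++ u) * pairCount v)
        (symWord (n :: l) ++ List.replicate k true) := by
  induction l generalizing n pre A with
  | nil =>
    rw [symWord_cons, List.append_assoc, List.append_assoc, splitSum_append,
      splitSum_replicate_ne (by simp), zero_add, splitSum_append, splitSum_replicate_self]
    exact (mul_le_sum_replicate k C n [] pre A hl (hA []) hC).trans (Nat.le_add_right _ _)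
  | cons n' l ih =>
    rw [symWord_cons, List.append_assoc, List.append_assoc, splitSum_append,
      splitSum_replicate_ne (by simp), zero_add, splitSum_append, splitSum_replicate_self,
      splitConv]
    refine Nat.add_le_add (mul_le_sum_replicate k C n _ pre A hl (hA []) hC) ?_
    have := ih n' (pre ++ (List.replicate n true ++ List.replicate n false))
      (fun p => A (n :: p)) (fun x hx => hl x (by simp at hx ⊢; tauto))
      (fun p x hx => by simpa [symWord_cons] using hA (n :: p) x hx)
    simpa using this

theorem symConv_le_pairCount (k : ℕ) (l : List ℕ) (hl : ∀ x ∈ l, k ≤ x) :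
    symConv k l ≤
      pairCount (List.replicate k false ++ (symWord l ++ List.replicate k true)) := by
  induction k generalizing l with
  | zero => simp [symConv]
  | succ k ih =>
    have hC : ∀ q : List ℕ, (∀ x ∈ q, k + 1 ≤ x) → symConv k q ≤
        pairCount (List.replicate k false ++ (symWord q ++ List.replicate k true)) :=
      fun q hq => ih q fun x hx => (Nat.le_succ k).trans (hq x hx)
    have h_one : pairCount (symWord []) = pairCount [] := rfl
    rw [List.replicate_succ' (a := true), ← List.append_assoc, ← List.append_assoc,
      pairCount_append_comm, List.singleton_append, pairCount_cons, List.append_assoc,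
      List.replicate_succ, List.cons_append, splitSum_cons]
    cases l with
    | nil =>
      rw [symConv, splitConv, h_one, if_pos (by simp)]
      exact (Nat.mul_le_mul_left _ (hC [] (by simp))).trans (Nat.le_add_right _ _)
    | cons n l =>
      rw [symConv, splitConv, h_one, if_pos (by simp), splitSum_append]
      refine Nat.add_le_add (Nat.mul_le_mul_left _ (hC _ hl)) (le_trans ?_ (Nat.le_add_left _ _))
      refine splitConv_le_splitSum k (symConv k) n l (List.replicate (k + 1) false)
        (fun p => pairCount (symWord p)) hl ?_ hC
      intro p x hx
      refine le_of_eq ?_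
      rw [pairCount_append_comm, symWord_append, symWord_cons, List.append_assoc,
        List.append_assoc, List.replicate_append_replicate, Nat.sub_add_cancel hx]
      simp [symWord]

theorem pairCount_replicate_append_runWord_le (c : ℕ) (L : List (ℕ × ℕ)) :
    pairCount (List.replicate c false ++ runWord L) ≤ pairCount (symWord (L.map Prod.fst)) := by
  induction hN : L.length using Nat.strong_induction_on generalizing c L with
  | _ N ih =>
    have main : ∀ L : List (ℕ × ℕ), L.length = N → L ≠ [] →
        pairCount (runWord L) ≤ pairCount (symWord (L.map Prod.fst)) := by
      intro L hL hne
      obtain ⟨⟨k, m⟩, hmem, hmin⟩ := Finset.exists_min_image L.toFinset Prod.fst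
        (List.toFinset_nonempty_iff _ |>.2 hne)
      obtain ⟨P, Q, rfl⟩ := List.append_of_mem (List.mem_toFinset.1 hmem)
      rw [runWord_append, pairCount_append_comm, ← runWord_append, List.map_append,
        symWord_append, pairCount_append_comm, ← symWord_append, ← List.map_append,
        List.cons_append, List.map_cons, runWord_cons, symWord_cons, pairCount_append_comm,
        List.append_assoc]
      refine (pairCount_le_symConv (Q ++ P) (fun B i hB => ?_) k _ m le_rfl).trans ?_
      · exact ih B.length (by simp at hL hB; omega) i B rfl
      · rw [pairCount_append_comm (List.replicate k true), List.append_assoc]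
        refine symConv_le_pairCount k _ fun x hx => ?_
        obtain ⟨p, hp, rfl⟩ := List.mem_map.1 hx
        exact hmin p (by simp at hp ⊢; tauto)
    rcases List.eq_nil_or_concat L with rfl | ⟨L', ⟨n, m⟩, rfl⟩
    · rcases Nat.eq_zero_or_pos c with rfl | hc
      · exact le_rfl
      · have : pairCount (List.replicate c false ++ runWord []) = 0 := by
          by_contra h
          have := count_eq_of_pairCount_ne_zero _ h
          simp [runWord_nil, List.count_replicate] at this
          omega
        rw [this]
        exact Nat.zero_le _
    · have := main (L' ++ [(n, m + c)]) (by simpa using hN) (by simp)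
      rw [pairCount_append_comm]
      simpa [runWord, ← List.replicate_append_replicate] using this

/-- The noncrossing pairings of the positions in `[a, b)` that pair positions with unequal
letters of `W`. -/
def intervalPairings (W : ℕ → Bool) (a b : ℕ) : Set (Finset (Finset ℕ)) :=
  {π | (∀ B ∈ π, B.card = 2 ∧ B ⊆ Finset.Ico a b) ∧
    (∀ i ∈ Finset.Ico a b, ∃ B ∈ π, i ∈ B) ∧
    (∀ B ∈ π, ∀ C ∈ π, ∀ i ∈ B, i ∈ C → B = C) ∧
    (∀ B ∈ π, ∀ C ∈ π, ∀ i₁ ∈ B, ∀ i₂ ∈ B, ∀ j₁ ∈ C, ∀ j₂ ∈ C,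
      ¬ (i₁ < j₁ ∧ j₁ < i₂ ∧ i₂ < j₂)) ∧
    ∀ B ∈ π, ∀ i ∈ B, ∀ j ∈ B, i ≠ j → W i ≠ W j}

theorem intervalPairings_finite (W : ℕ → Bool) (a b : ℕ) : (intervalPairings W a b).Finite := by
  refine (Finset.finite_toSet (Finset.Ico a b).powerset.powerset).subset fun π hπ => ?_
  simp only [Finset.mem_coe, Finset.mem_powerset]
  intro B hB
  exact Finset.mem_powerset.2 (hπ.1 B hB).2

theorem intervalPairings_self (W : ℕ → Bool) (a : ℕ) : intervalPairings W a a = {∅} := by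
  ext π
  simp only [Set.mem_singleton_iff]
  constructor
  · intro h
    by_contra hne
    obtain ⟨B, hB⟩ := Finset.nonempty_iff_ne_empty.2 hne
    obtain ⟨h1, h2⟩ := h.1 B hB
    rw [Finset.Ico_self, Finset.subset_empty] at h2
    simp [h2] at h1
  · rintro rfl
    simp [intervalPairings]

theorem insert_union_mem_intervalPairings {W : ℕ → Bool} {a k b : ℕ} (hak : a < k) (hkb : k < b)
    (hW : W a ≠ W k) {π₁ π₂ : Finset (Finset ℕ)} (h₁ : π₁ ∈ intervalPairings W (a + 1) k)
    (h₂ : π₂ ∈ intervalPairings W (k + 1) b) :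
    insert {a, k} (π₁ ∪ π₂) ∈ intervalPairings W a b := by
  obtain ⟨p1, p2, p3, p4, p5⟩ := h₁
  obtain ⟨q1, q2, q3, q4, q5⟩ := h₂
  have p6 : ∀ B ∈ π₁, ∀ i ∈ B, a + 1 ≤ i ∧ i < k := fun B hB i hi =>
    Finset.mem_Ico.1 ((p1 B hB).2 hi)
  have q6 : ∀ B ∈ π₂, ∀ i ∈ B, k + 1 ≤ i ∧ i < b := fun B hB i hi =>
    Finset.mem_Ico.1 ((q1 B hB).2 hi)
  refine ⟨?_, ?_, ?_, ?_, ?_⟩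
  · intro B hB
    simp only [Finset.mem_insert, Finset.mem_union] at hB
    refine ⟨?_, ?_⟩
    · rcases hB with rfl | hB | hB
      · exact Finset.card_pair hak.ne
      · exact (p1 B hB).1
      · exact (q1 B hB).1
    · intro i hi
      rw [Finset.mem_Ico]
      rcases hB with rfl | hB | hB
      · simp only [Finset.mem_insert, Finset.mem_singleton] at hi
        omega
      · have := p6 B hB i hi
        omega
      · have := q6 B hB i hi
        omega
  · intro i hi
    rw [Finset.mem_Ico] at hi
    by_cases hi' : i = a ∨ i = k
    · exact ⟨{a, k}, by simp, by simpa using hi'⟩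
    · rcases lt_or_gt_of_ne (not_or.1 hi').2 with h | h
      · obtain ⟨B, hB, hiB⟩ := p2 i (Finset.mem_Ico.2 (by omega))
        exact ⟨B, by simp [hB], hiB⟩
      · obtain ⟨B, hB, hiB⟩ := q2 i (Finset.mem_Ico.2 (by omega))
        exact ⟨B, by simp [hB], hiB⟩
  · intro B hB C hC i hiB hiC
    simp only [Finset.mem_insert, Finset.mem_union] at hB hC
    have hk : ∀ {j}, j ∈ ({a, k} : Finset ℕ) → j = a ∨ j = k := by simp
    rcases hB with rfl | hB | hB <;> rcases hC with rfl | hC | hC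
    · rfl
    · have := hk hiB
      have := p6 C hC i hiC
      omega
    · have := hk hiB
      have := q6 C hC i hiC
      omega
    · have := hk hiC
      have := p6 B hB i hiB
      omega
    · exact p3 B hB C hC i hiB hiC
    · have := p6 B hB i hiB
      have := q6 C hC i hiC
      omega
    · have := hk hiC
      have := q6 B hB i hiB
      omega
    · have := q6 B hB i hiB
      have := p6 C hC i hiC
      omega
    · exact q3 B hB C hC i hiB hiC
  · intro B hB C hC i₁ h1 i₂ h2 j₁ h3 j₂ h4
    simp only [Finset.mem_insert, Finset.mem_union] at hB hC
    rcases hB with rfl | hB | hB <;> rcases hC with rfl | hC | hC <;> grind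
  · intro B hB i hi j hj hij
    simp only [Finset.mem_insert, Finset.mem_union] at hB
    rcases hB with rfl | hB | hB
    · simp only [Finset.mem_insert, Finset.mem_singleton] at hi hj
      grind
    · exact p5 B hB i hi j hj hij
    · exact q5 B hB i hi j hj hij

theorem filter_mem_intervalPairings {W : ℕ → Bool} {a b c d : ℕ} {π : Finset (Finset ℕ)}
    (hπ : π ∈ intervalPairings W a b) (hac : a ≤ c) (hdb : d ≤ b)
    (h : ∀ B ∈ π, ∀ i ∈ B, i ∈ Finset.Ico c d → B ⊆ Finset.Ico c d) :
    π.filter (· ⊆ Finset.Ico c d) ∈ intervalPairings W c d := by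
  obtain ⟨p1, p2, p3, p4, p5⟩ := hπ
  refine ⟨?_, ?_, ?_, ?_, ?_⟩
  · intro B hB
    rw [Finset.mem_filter] at hB
    exact ⟨(p1 B hB.1).1, hB.2⟩
  · intro i hi
    obtain ⟨B, hB, hiB⟩ := p2 i (Finset.Ico_subset_Ico hac hdb hi)
    exact ⟨B, Finset.mem_filter.2 ⟨hB, h B hB i hiB hi⟩, hiB⟩
  · intro B hB C hC
    exact p3 B (Finset.mem_filter.1 hB).1 C (Finset.mem_filter.1 hC).1
  · intro B hB C hC
    exact p4 B (Finset.mem_filter.1 hB).1 C (Finset.mem_filter.1 hC).1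
  · intro B hB
    exact p5 B (Finset.mem_filter.1 hB).1

theorem exists_eq_insert_union {W : ℕ → Bool} {a b : ℕ} (hab : a < b) {π : Finset (Finset ℕ)}
    (hπ : π ∈ intervalPairings W a b) :
    ∃ k, (a < k ∧ k < b ∧ W a ≠ W k) ∧ ∃ π₁ ∈ intervalPairings W (a + 1) k,
      ∃ π₂ ∈ intervalPairings W (k + 1) b, π = insert {a, k} (π₁ ∪ π₂) := by
  have hπ' := hπ
  obtain ⟨p1, p2, p3, p4, p5⟩ := hπ
  obtain ⟨B₀, hB₀, haB₀⟩ := p2 a (by simp [hab])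
  obtain ⟨k, hk⟩ : ∃ k, B₀ = {a, k} := by
    obtain ⟨x, y, hxy, h⟩ := Finset.card_eq_two.1 (p1 B₀ hB₀).1
    subst h
    simp only [Finset.mem_insert, Finset.mem_singleton] at haB₀
    rcases haB₀ with rfl | rfl
    · exact ⟨y, rfl⟩
    · exact ⟨x, Finset.pair_comm _ _⟩
  subst hk
  have hak : a ≠ k := by
    rintro rfl
    simpa using (p1 _ hB₀).1
  have hk := (p1 _ hB₀).2 (show k ∈ ({a, k} : Finset ℕ) by simp)
  rw [Finset.mem_Ico] at hk
  have key : ∀ B ∈ π, B ≠ {a, k} → B ⊆ Finset.Ico (a + 1) k ∨ B ⊆ Finset.Ico (k + 1) b := by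
    intro B hB hne
    obtain ⟨x, y, hxy, h⟩ := Finset.card_eq_two.1 (p1 B hB).1
    have hx : x ∈ B := by simp [h]
    have hy : y ∈ B := by simp [h]
    have hx' := Finset.mem_Ico.1 ((p1 B hB).2 hx)
    have hy' := Finset.mem_Ico.1 ((p1 B hB).2 hy)
    have ne : ∀ z ∈ B, z ≠ a ∧ z ≠ k := fun z hz =>
      ⟨fun e => hne (p3 B hB _ hB₀ z hz (by simp [e])),
        fun e => hne (p3 B hB _ hB₀ z hz (by simp [e]))⟩
    have hxn := ne x hx
    have hyn := ne y hy
    have c1 := p4 _ hB₀ B hB a (by simp) k (by simp) x hx y hy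
    have c2 := p4 _ hB₀ B hB a (by simp) k (by simp) y hy x hx
    simp only [h, Finset.insert_subset_iff, Finset.singleton_subset_iff, Finset.mem_Ico]
    omega
  refine ⟨k, ⟨by omega, hk.2, p5 _ hB₀ a (by simp) k (by simp) hak⟩,
    π.filter (· ⊆ Finset.Ico (a + 1) k), ?_, π.filter (· ⊆ Finset.Ico (k + 1) b), ?_, ?_⟩
  · refine filter_mem_intervalPairings hπ' (by omega) (by omega) fun B hB i hi hi' => ?_
    rw [Finset.mem_Ico] at hi'
    rcases key B hB (by rintro rfl; simp at hi; omega) with h | h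
    · exact h
    · have := Finset.mem_Ico.1 (h hi)
      omega
  · refine filter_mem_intervalPairings hπ' (by omega) le_rfl fun B hB i hi hi' => ?_
    rw [Finset.mem_Ico] at hi'
    rcases key B hB (by rintro rfl; simp at hi; omega) with h | h
    · have := Finset.mem_Ico.1 (h hi)
      omega
    · exact h
  · ext B
    simp only [Finset.mem_insert, Finset.mem_union, Finset.mem_filter]
    constructor
    · intro hB
      by_cases hne : B = {a, k}
      · exact Or.inl hne
      · have := key B hB hne
        tauto
    · rintro (rfl | h | h)
      · exact hB₀
      · exact h.1
      · exact h.1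

theorem filter_insert_union {W : ℕ → Bool} {a k b : ℕ} (hak : a < k) {π₁ π₂ : Finset (Finset ℕ)}
    (h₁ : π₁ ∈ intervalPairings W (a + 1) k) (h₂ : π₂ ∈ intervalPairings W (k + 1) b) :
    (insert {a, k} (π₁ ∪ π₂)).filter (· ⊆ Finset.Ico (a + 1) k) = π₁ ∧
      (insert {a, k} (π₁ ∪ π₂)).filter (· ⊆ Finset.Ico (k + 1) b) = π₂ := by
  have card₁ : ∀ B ∈ π₁, B.Nonempty := fun B hB =>
    Finset.card_pos.1 (by rw [(h₁.1 B hB).1]; exact two_pos)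
  have card₂ : ∀ B ∈ π₂, B.Nonempty := fun B hB =>
    Finset.card_pos.1 (by rw [(h₂.1 B hB).1]; exact two_pos)
  constructor
  · ext B
    simp only [Finset.mem_insert, Finset.mem_union, Finset.mem_filter]
    refine ⟨?_, fun h => ⟨Or.inr (Or.inl h), (h₁.1 B h).2⟩⟩
    rintro ⟨rfl | h | h, hs⟩
    · simpa using hs (show a ∈ ({a, k} : Finset ℕ) by simp)
    · exact h
    · obtain ⟨x, hx⟩ := card₂ B h
      have := Finset.mem_Ico.1 (hs hx)
      have := Finset.mem_Ico.1 ((h₂.1 B h).2 hx)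
      omega
  · ext B
    simp only [Finset.mem_insert, Finset.mem_union, Finset.mem_filter]
    refine ⟨?_, fun h => ⟨Or.inr (Or.inr h), (h₂.1 B h).2⟩⟩
    rintro ⟨rfl | h | h, hs⟩
    · have := Finset.mem_Ico.1 (hs (show a ∈ ({a, k} : Finset ℕ) by simp))
      omega
    · obtain ⟨x, hx⟩ := card₁ B h
      have := Finset.mem_Ico.1 (hs hx)
      have := Finset.mem_Ico.1 ((h₁.1 B h).2 hx)
      omega
    · exact h

theorem eq_of_insert_union_eq {W : ℕ → Bool} {a k k' b : ℕ} (hak : a < k)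
    {π₁ π₂ π₁' π₂' : Finset (Finset ℕ)}
    (h₁ : π₁' ∈ intervalPairings W (a + 1) k') (h₂ : π₂' ∈ intervalPairings W (k' + 1) b)
    (hak' : a < k')
    (h : insert {a, k} (π₁ ∪ π₂) = insert {a, k'} (π₁' ∪ π₂')) : k = k' := by
  have hmem : {a, k} ∈ insert {a, k'} (π₁' ∪ π₂') := h ▸ Finset.mem_insert_self _ _
  have ha : a ∈ ({a, k} : Finset ℕ) := by simp
  simp only [Finset.mem_insert, Finset.mem_union] at hmem
  rcases hmem with e | e | e
  · have hk : k ∈ ({a, k'} : Finset ℕ) := e ▸ (by simp)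
    simp only [Finset.mem_insert, Finset.mem_singleton] at hk
    omega
  · have := Finset.mem_Ico.1 ((h₁.1 _ e).2 ha)
    omega
  · have := Finset.mem_Ico.1 ((h₂.1 _ e).2 ha)
    omega

theorem ncard_intervalPairings {W : ℕ → Bool} {a b : ℕ} (hab : a < b) :
    (intervalPairings W a b).ncard = ∑ k ∈ Finset.Ico (a + 1) b,
      if W a ≠ W k then
        (intervalPairings W (a + 1) k).ncard * (intervalPairings W (k + 1) b).ncard else 0 := by
  simp only [Set.ncard_eq_toFinset_card _ (intervalPairings_finite _ _ _),
    ← Finset.sum_filter, ← Finset.card_product, ← Finset.card_sigma]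
  symm
  refine Finset.card_bij (fun x _ => insert {a, x.1} (x.2.1 ∪ x.2.2)) ?_ ?_ ?_
  · rintro ⟨k, π₁, π₂⟩ h
    simp only [Finset.mem_sigma, Finset.mem_filter, Finset.mem_Ico, Finset.mem_product,
      Set.Finite.mem_toFinset] at h ⊢
    exact insert_union_mem_intervalPairings h.1.1.1 h.1.1.2 h.1.2 h.2.1 h.2.2
  · rintro ⟨k, π₁, π₂⟩ h ⟨k', π₁', π₂'⟩ h' heq
    simp only [Finset.mem_sigma, Finset.mem_filter, Finset.mem_Ico, Finset.mem_product,
      Set.Finite.mem_toFinset] at h h' heq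
    obtain rfl := eq_of_insert_union_eq h.1.1.1 h'.2.1 h'.2.2 h'.1.1.1 heq
    obtain ⟨e₁, e₂⟩ := filter_insert_union h.1.1.1 h.2.1 h.2.2
    obtain ⟨e₁', e₂'⟩ := filter_insert_union h.1.1.1 h'.2.1 h'.2.2
    rw [heq] at e₁ e₂
    rw [← e₁, ← e₂, e₁', e₂']
  · intro π hπ
    rw [Set.Finite.mem_toFinset] at hπ
    obtain ⟨k, ⟨h1, h2, h3⟩, π₁, h₁, π₂, h₂, rfl⟩ := exists_eq_insert_union hab hπ
    refine ⟨⟨k, π₁, π₂⟩, ?_, rfl⟩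
    simp only [Finset.mem_sigma, Finset.mem_filter, Finset.mem_Ico, Finset.mem_product,
      Set.Finite.mem_toFinset]
    exact ⟨⟨⟨h1, h2⟩, h3⟩, h₁, h₂⟩

theorem pairCount_map_range' (W : ℕ → Bool) (a n : ℕ) :
    pairCount ((List.range' a n).map W) = (intervalPairings W a (a + n)).ncard := by
  induction n using Nat.strong_induction_on generalizing a with
  | _ n ih =>
    cases n with
    | zero => simp [pairCount_nil, intervalPairings_self]
    | succ n =>
      rw [ncard_intervalPairings (by omega), List.range'_succ, List.map_cons, pairCount,
        Finset.sum_Ico_eq_sum_range, show a + (n + 1) - (a + 1) = n by omega]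
      refine Finset.sum_congr (by simp) fun i hi => ?_
      have hi : i < n := by simpa using hi
      have htake : (List.range' (a + 1) n).take i = List.range' (a + 1) i :=
        List.take_range'_of_length_ge hi.le
      have hdrop : (List.range' (a + 1) n).drop (i + 1) =
          List.range' (a + 1 + i + 1) (n - (i + 1)) := by
        rw [List.drop_range']
        congr 1
        omega
      rw [← List.map_take, ← List.map_drop, htake, hdrop, ih i (by omega),
        ih (n - (i + 1)) (by omega)]
      have hget : (List.map W (List.range' (a + 1) n))[i]? = some (W (a + 1 + i)) := by
        simp [hi]
      rw [hget]
      have hb : a + 1 + i + 1 + (n - (i + 1)) = a + (n + 1) := by omega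
      rw [hb]
      congr 1
      simp only [Option.some.injEq, eq_iff_iff, ne_eq]
      cases W a <;> cases W (a + 1 + i) <;> simp

theorem isNCPairingOn_iff (w : List Bool) (π : Finset (Finset (Fin w.length))) :
    IsNCPairingOn w π ↔ π.map (Finset.mapEmbedding Fin.valEmbedding).toEmbedding ∈
      intervalPairings (fun i => w.getD i false) 0 w.length := by
  have hget : ∀ i : Fin w.length, w.getD i false = w.get i := fun i => by simp
  simp only [IsNCPairingOn, IsPairing, HasCrossing, intervalPairings, Set.mem_ofPred_eq,
    Finset.mem_map, RelEmbedding.coe_toEmbedding, Finset.mapEmbedding_apply,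
    forall_exists_index, and_imp, forall_apply_eq_imp_iff₂, Finset.card_map,
    Fin.valEmbedding_apply, hget, Fin.val_fin_lt, exists_exists_and_eq_and]
  constructor
  · rintro ⟨⟨h1, h2⟩, h3, h4⟩
    refine ⟨fun B hB => ⟨h1 B hB, fun i hi => ?_⟩, fun i hi => ?_, ?_, ?_, ?_⟩
    · obtain ⟨j, _, rfl⟩ := Finset.mem_map.1 hi
      simp
    · obtain ⟨B, ⟨hB, hiB⟩, _⟩ := h2 ⟨i, (Finset.mem_Ico.1 hi).2⟩
      exact ⟨B, hB, _, hiB, rfl⟩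
    · intro B hB C hC i hi j hj hij
      obtain rfl := Fin.ext hij
      rw [(h2 j).unique ⟨hB, hi⟩ ⟨hC, hj⟩]
    · rintro B hB C hC i₁ k1 i₂ k2 j₁ k3 j₂ k4 ⟨l1, l2, l3⟩
      exact h3 ⟨B, hB, C, hC, i₁, i₂, j₁, j₂, k1, k2, k3, k4, l1, l2, l3⟩
    · intro B hB i hi j hj hij
      exact h4 B hB i hi j hj fun e => hij (by rw [e])
  · rintro ⟨h1, h2, h3, h4, h5⟩
    refine ⟨⟨fun B hB => (h1 B hB).1, fun i => ?_⟩, ?_, fun B hB i hi j hj hij => ?_⟩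
    · obtain ⟨B, hB, j, hj, hji⟩ := h2 i (by simp)
      obtain rfl := Fin.ext hji
      refine ⟨B, ⟨hB, hj⟩, fun C hC => ?_⟩
      exact Finset.map_injective _ (h3 C hC.1 B hB j hC.2 j hj rfl)
    · rintro ⟨B, hB, C, hC, i₁, i₂, j₁, j₂, k1, k2, k3, k4, l1, l2, l3⟩
      exact h4 B hB C hC i₁ k1 i₂ k2 j₁ k3 j₂ k4 ⟨l1, l2, l3⟩
    · exact h5 B hB i hi j hj fun e => hij (Fin.ext e)

theorem phi_eq_pairCount (w : List Bool) : phi w = pairCount w := by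
  have hw : w = (List.range' 0 w.length).map fun i => w.getD i false := by
    refine List.ext_getElem (by simp) fun i h1 h2 => ?_
    simp [h1]
  conv_rhs => rw [hw]
  rw [pairCount_map_range', phi, zero_add,
    ← Set.ncard_image_of_injective _ (Finset.map_injective
      (Finset.mapEmbedding (Fin.valEmbedding (n := w.length))).toEmbedding)]
  congr 1
  ext ρ
  constructor
  · rintro ⟨π, hπ, rfl⟩
    exact (isNCPairingOn_iff w π).1 hπ
  · intro hρ
    have heq : (Finset.univ.filter fun B : Finset (Fin w.length) =>
        B.map Fin.valEmbedding ∈ ρ).map (Finset.mapEmbedding Fin.valEmbedding).toEmbedding = ρ := by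
      ext C
      simp only [Finset.mem_map, Finset.mem_filter, Finset.mem_univ, true_and,
        RelEmbedding.coe_toEmbedding, Finset.mapEmbedding_apply]
      constructor
      · rintro ⟨B, hB, rfl⟩
        exact hB
      · intro hC
        have hlt : ∀ x ∈ C, x < w.length := fun x hx =>
          (Finset.mem_Ico.1 ((hρ.1 C hC).2 hx)).2
        have := Finset.map_valEmbedding_attachFin hlt
        exact ⟨C.attachFin hlt, by rwa [this], this⟩
    exact ⟨_, (isNCPairingOn_iff w _).2 (by rwa [heq]), heq⟩

/-- If `n₁ = min{n₁, m₁, …, n_r, m_r}`, then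
`φ(1^{n₁}0^{m₁}⋯1^{n_r}0^{m_r}) ≤ φ*(n₁, n₂, …, n_r)`. -/
theorem stmt12 (r : ℕ) (hr : 1 ≤ r) (n m : Fin r → ℕ)
    (hn : ∀ i, 1 ≤ n i) (hm : ∀ i, 1 ≤ m i)
    (hbal : ∑ i, n i = ∑ i, m i)
    (hmin : ∀ i, n ⟨0, hr⟩ ≤ n i ∧ n ⟨0, hr⟩ ≤ m i) :
    phi (runsF n m) ≤ phiStar ((List.finRange r).map n) := by
  have hrun : runsF n m = runWord ((List.finRange r).map fun i => (n i, m i)) := by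
    simp [runsF, runWord, List.flatMap_map]
  rw [phiStar, phi_eq_pairCount, phi_eq_pairCount, hrun]
  simpa [Function.comp_def] using
    pairCount_replicate_append_runWord_le 0 ((List.finRange r).map fun i => (n i, m i))
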